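/- arXiv:2101.00412 — 3 statements merged into one kernel-verified Lean document; each statement's English description precedes it below -/
import Mathlib

section
/- Suppose there exists α > 0 such that ⟨M₁₁u₁,u₁⟩ ≥ α‖u₁‖² for all u₁ ∈ H₁ and ⟨M₂₂u₂,u₂⟩ ≤ −α‖u₂‖² for all u₂ ∈ H₂ (the uniform convexity-concavity condition). Then the block operator M is invertible. -/
open scoped RealInnerProductSpace

/-- The block operator `(u₁, u₂) ↦ (M₁₁u₁ + M₁₂u₂, M₂₁u₁ + M₂₂u₂)` on the product
Hilbert space `H₁ ×₂ H₂` (with the `L²` product norm). -/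
noncomputable def blockOp {H₁ H₂ : Type*}
    [NormedAddCommGroup H₁] [InnerProductSpace ℝ H₁]
    [NormedAddCommGroup H₂] [InnerProductSpace ℝ H₂]
    (M11 : H₁ →L[ℝ] H₁) (M12 : H₂ →L[ℝ] H₁)
    (M21 : H₁ →L[ℝ] H₂) (M22 : H₂ →L[ℝ] H₂) :
    WithLp 2 (H₁ × H₂) →L[ℝ] WithLp 2 (H₁ × H₂) :=
  ((WithLp.prodContinuousLinearEquiv 2 ℝ H₁ H₂).symm.toContinuousLinearMap) ∘L
    ((M11 ∘L ContinuousLinearMap.fst ℝ H₁ H₂ + M12 ∘L ContinuousLinearMap.snd ℝ H₁ H₂).prod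
      (M21 ∘L ContinuousLinearMap.fst ℝ H₁ H₂ + M22 ∘L ContinuousLinearMap.snd ℝ H₁ H₂)) ∘L
    ((WithLp.prodContinuousLinearEquiv 2 ℝ H₁ H₂).toContinuousLinearMap)

/-- The element of the product Hilbert space `H₁ ×₂ H₂` with components `a` and `b`. -/
noncomputable def pairL2 {H₁ H₂ : Type*}
    [NormedAddCommGroup H₁] [InnerProductSpace ℝ H₁]
    [NormedAddCommGroup H₂] [InnerProductSpace ℝ H₂]
    (a : H₁) (b : H₂) : WithLp 2 (H₁ × H₂) :=
  (WithLp.equiv 2 (H₁ × H₂)).symm (a, b)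

/-- A bounded operator `T` on a real Hilbert space with `⟪T v, v⟫ ≥ c ‖v‖²` for some `c > 0`
is a continuous linear equivalence (Lax-Milgram). -/
theorem ContinuousLinearMap.exists_continuousLinearEquiv_of_le_inner {V : Type*}
    [NormedAddCommGroup V] [InnerProductSpace ℝ V] [CompleteSpace V]
    (T : V →L[ℝ] V) {c : ℝ} (hc : 0 < c) (hT : ∀ v, c * ‖v‖ ^ 2 ≤ ⟪T v, v⟫) :
    ∃ e : V ≃L[ℝ] V, ∀ v, e v = T v := by
  have h : IsCoercive (innerSL ℝ ∘L T) :=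
    ⟨c, hc, fun v => by simpa [pow_two, mul_assoc, innerSL_apply_apply ℝ] using hT v⟩
  exact ⟨h.continuousLinearEquivOfBilin, fun v =>
    (h.unique_continuousLinearEquivOfBilin fun w => by simp [innerSL_apply_apply ℝ]).symm⟩

section BlockOp

variable {H₁ H₂ : Type*}
  [NormedAddCommGroup H₁] [InnerProductSpace ℝ H₁]
  [NormedAddCommGroup H₂] [InnerProductSpace ℝ H₂]
  (M11 : H₁ →L[ℝ] H₁) (M12 : H₂ →L[ℝ] H₁)
  (M21 : H₁ →L[ℝ] H₂) (M22 : H₂ →L[ℝ] H₂)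

theorem blockOp_apply (u : WithLp 2 (H₁ × H₂)) :
    blockOp M11 M12 M21 M22 u =
      WithLp.toLp 2 (M11 u.fst + M12 u.snd, M21 u.fst + M22 u.snd) := rfl

theorem blockOp_sign_sign (u : WithLp 2 (H₁ × H₂)) :
    blockOp (.id ℝ H₁) 0 0 (-.id ℝ H₂) (blockOp (.id ℝ H₁) 0 0 (-.id ℝ H₂) u) = u := by
  simp only [blockOp_apply]
  simp
  rfl

theorem inner_blockOp_sign_blockOp_self [CompleteSpace H₁] [CompleteSpace H₂]
    (u : WithLp 2 (H₁ × H₂)) :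
    ⟪blockOp (.id ℝ H₁) 0 0 (-.id ℝ H₂) (blockOp M11 M12 (M12.adjoint) M22 u), u⟫ =
      ⟪M11 u.fst, u.fst⟫ - ⟪M22 u.snd, u.snd⟫ := by
  simp only [blockOp_apply, WithLp.prod_inner_apply]
  simp [inner_add_left, ContinuousLinearMap.adjoint_inner_left,
    real_inner_comm u.fst (M12 u.snd)]
  ring

end BlockOp

/-- Under the uniform convexity-concavity condition (`⟨M₁₁u₁,u₁⟩ ≥ α‖u₁‖²` and
`⟨M₂₂u₂,u₂⟩ ≤ −α‖u₂‖²` for some `α > 0`), the block operator `M` is invertible. -/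
theorem block_operator_invertible_of_uniform_convex_concave {H₁ H₂ : Type*}
    [NormedAddCommGroup H₁] [InnerProductSpace ℝ H₁] [CompleteSpace H₁]
    [NormedAddCommGroup H₂] [InnerProductSpace ℝ H₂] [CompleteSpace H₂]
    (M11 : H₁ →L[ℝ] H₁) (M12 : H₂ →L[ℝ] H₁)
    (M21 : H₁ →L[ℝ] H₂) (M22 : H₂ →L[ℝ] H₂)
    (h21 : M21 = ContinuousLinearMap.adjoint M12)
    (h11sa : IsSelfAdjoint M11) (h22sa : IsSelfAdjoint M22)
    (α : ℝ) (hα : 0 < α)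
    (h11 : ∀ u₁ : H₁, α * ‖u₁‖ ^ 2 ≤ ⟪M11 u₁, u₁⟫)
    (h22 : ∀ u₂ : H₂, ⟪M22 u₂, u₂⟫ ≤ -(α * ‖u₂‖ ^ 2)) :
    ∃ S : WithLp 2 (H₁ × H₂) →L[ℝ] WithLp 2 (H₁ × H₂),
      S ∘L blockOp M11 M12 M21 M22 = ContinuousLinearMap.id ℝ _ ∧
      blockOp M11 M12 M21 M22 ∘L S = ContinuousLinearMap.id ℝ _ := by
  subst h21
  obtain ⟨e, he⟩ := ContinuousLinearMap.exists_continuousLinearEquiv_of_le_inner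
    (blockOp (.id ℝ H₁) 0 0 (-.id ℝ H₂) ∘L blockOp M11 M12 (M12.adjoint) M22) hα fun u => by
      rw [ContinuousLinearMap.comp_apply, inner_blockOp_sign_blockOp_self,
        WithLp.prod_norm_sq_eq_of_L2]
      linarith [h11 u.fst, h22 u.snd]
  simp only [ContinuousLinearMap.comp_apply] at he
  refine ⟨e.symm.toContinuousLinearMap ∘L blockOp (.id ℝ H₁) 0 0 (-.id ℝ H₂),
    ContinuousLinearMap.ext fun u => ?_, ContinuousLinearMap.ext fun u => ?_⟩
  · simp [← he]
  · rw [← blockOp_sign_sign ((blockOp M11 M12 (M12.adjoint) M22 ∘L _) u)]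
    simp [← he, blockOp_sign_sign]
end

section
/- Suppose there exists α > 0 such that ⟨M₁₁u₁,u₁⟩ ≥ α‖u₁‖² for all u₁ ∈ H₁ and ⟨M₂₂u₂,u₂⟩ ≤ −α‖u₂‖² for all u₂ ∈ H₂. Then for every k ∈ H and c ∈ ℝ, the quadratic functional J(u) = ⟨Mu,u⟩ + 2⟨k,u⟩ + c admits a unique saddle point, given by u* = −M⁻¹k. -/
open scoped RealInnerProductSpace

/-- The quadratic functional `J(u) = ⟨Mu,u⟩ + 2⟨k,u⟩ + c` on the product Hilbert space. -/
noncomputable def quadJ {H₁ H₂ : Type*}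
    [NormedAddCommGroup H₁] [InnerProductSpace ℝ H₁]
    [NormedAddCommGroup H₂] [InnerProductSpace ℝ H₂]
    (M11 : H₁ →L[ℝ] H₁) (M12 : H₂ →L[ℝ] H₁)
    (M21 : H₁ →L[ℝ] H₂) (M22 : H₂ →L[ℝ] H₂)
    (k : WithLp 2 (H₁ × H₂)) (c : ℝ) (u : WithLp 2 (H₁ × H₂)) : ℝ :=
  ⟪blockOp M11 M12 M21 M22 u, u⟫ + 2 * ⟪k, u⟫ + c

/-- `(a, b)` is a saddle point of `J : H₁ ×₂ H₂ → ℝ`: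
`J(a, u₂) ≤ J(a, b) ≤ J(u₁, b)` for all `u₁ ∈ H₁`, `u₂ ∈ H₂`. -/
def IsSaddlePoint {H₁ H₂ : Type*}
    [NormedAddCommGroup H₁] [InnerProductSpace ℝ H₁]
    [NormedAddCommGroup H₂] [InnerProductSpace ℝ H₂]
    (J : WithLp 2 (H₁ × H₂) → ℝ) (a : H₁) (b : H₂) : Prop :=
  (∀ u₂ : H₂, J (pairL2 a u₂) ≤ J (pairL2 a b)) ∧
    (∀ u₁ : H₁, J (pairL2 a b) ≤ J (pairL2 u₁ b))

section SaddlePoint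

variable {H₁ H₂ : Type*}
  [NormedAddCommGroup H₁] [InnerProductSpace ℝ H₁]
  [NormedAddCommGroup H₂] [InnerProductSpace ℝ H₂]

theorem blockOp_fst (M11 : H₁ →L[ℝ] H₁) (M12 : H₂ →L[ℝ] H₁)
    (M21 : H₁ →L[ℝ] H₂) (M22 : H₂ →L[ℝ] H₂) (u : WithLp 2 (H₁ × H₂)) :
    (blockOp M11 M12 M21 M22 u).fst = M11 u.fst + M12 u.snd :=
  rfl

theorem blockOp_snd (M11 : H₁ →L[ℝ] H₁) (M12 : H₂ →L[ℝ] H₁)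
    (M21 : H₁ →L[ℝ] H₂) (M22 : H₂ →L[ℝ] H₂) (u : WithLp 2 (H₁ × H₂)) :
    (blockOp M11 M12 M21 M22 u).snd = M21 u.fst + M22 u.snd :=
  rfl

theorem pairL2_fst (a : H₁) (b : H₂) : (pairL2 a b).fst = a :=
  rfl

theorem pairL2_snd (a : H₁) (b : H₂) : (pairL2 a b).snd = b :=
  rfl

theorem quadJ_pairL2 (M11 : H₁ →L[ℝ] H₁) (M12 : H₂ →L[ℝ] H₁)
    (M21 : H₁ →L[ℝ] H₂) (M22 : H₂ →L[ℝ] H₂)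
    (k : WithLp 2 (H₁ × H₂)) (c : ℝ) (a : H₁) (b : H₂) :
    quadJ M11 M12 M21 M22 k c (pairL2 a b) =
      ⟪M11 a, a⟫ + ⟪M12 b, a⟫ + ⟪M21 a, b⟫ + ⟪M22 b, b⟫
        + 2 * (⟪k.fst, a⟫ + ⟪k.snd, b⟫) + c := by
  simp only [quadJ, WithLp.prod_inner_apply, WithLp.ofLp_fst, WithLp.ofLp_snd,
    blockOp_fst, blockOp_snd, pairL2_fst, pairL2_snd, inner_add_left]
  ring

/-- A bounded operator on a Hilbert space with `α‖u‖² ≤ ⟪Tu, u⟫` is onto (Lax–Milgram). -/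
theorem ContinuousLinearMap.surjective_of_coercive {H : Type*} [NormedAddCommGroup H]
    [InnerProductSpace ℝ H] [CompleteSpace H] (T : H →L[ℝ] H) {α : ℝ} (hα : 0 < α)
    (hT : ∀ u, α * ‖u‖ ^ 2 ≤ ⟪T u, u⟫) : Function.Surjective T := by
  have hB : IsCoercive (innerSL ℝ ∘L T) :=
    ⟨α, hα, fun u => (by rw [mul_assoc, ← pow_two]; exact hT u)⟩
  have hBT : ∀ u, hB.continuousLinearEquivOfBilin u = T u := fun u =>
    ext_inner_right ℝ fun w => (hB.continuousLinearEquivOfBilin_apply u w).trans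
      (innerSL_apply_apply ℝ (T u) w)
  intro v
  exact ⟨hB.continuousLinearEquivOfBilin.symm v, by simp [← hBT]⟩

variable [CompleteSpace H₁] [CompleteSpace H₂]

/-- Under uniform convexity-concavity the block operator is onto. -/
theorem blockOp_surjective {M11 : H₁ →L[ℝ] H₁} {M12 : H₂ →L[ℝ] H₁} {M22 : H₂ →L[ℝ] H₂}
    {α : ℝ} (hα : 0 < α)
    (h11 : ∀ u₁ : H₁, α * ‖u₁‖ ^ 2 ≤ ⟪M11 u₁, u₁⟫)
    (h22 : ∀ u₂ : H₂, ⟪M22 u₂, u₂⟫ ≤ -(α * ‖u₂‖ ^ 2)) :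
    Function.Surjective (blockOp M11 M12 (ContinuousLinearMap.adjoint M12) M22) := by
  have hT : Function.Surjective (blockOp M11 M12 (-ContinuousLinearMap.adjoint M12) (-M22)) := by
    refine ContinuousLinearMap.surjective_of_coercive _ hα fun u => ?_
    simp only [WithLp.prod_norm_sq_eq_of_L2, WithLp.prod_inner_apply, WithLp.ofLp_fst,
      WithLp.ofLp_snd, blockOp_fst, blockOp_snd, inner_add_left, neg_apply,
      inner_neg_left, ContinuousLinearMap.adjoint_inner_left, real_inner_comm u.fst (M12 u.snd)]
    linarith [h11 u.fst, h22 u.snd]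
  intro v
  obtain ⟨u, hu⟩ := hT (pairL2 v.fst (-v.snd))
  have h1 := congrArg WithLp.fst hu
  have h2 := congrArg WithLp.snd hu
  simp only [blockOp_fst, blockOp_snd, pairL2_fst, pairL2_snd,
    neg_apply] at h1 h2
  refine ⟨u, WithLp.ofLp_injective 2 (Prod.ext h1 ?_)⟩
  change (blockOp _ _ _ _ u).snd = v.snd
  rw [blockOp_snd, ← neg_inj, ← h2]
  abel

variable {M11 : H₁ →L[ℝ] H₁} {M12 : H₂ →L[ℝ] H₁} {M22 : H₂ →L[ℝ] H₂}
  {k : WithLp 2 (H₁ × H₂)} {a : H₁} {b : H₂}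

theorem quadJ_fst_eq_of_stationary (h11sa : IsSelfAdjoint M11)
    (h : M11 a + M12 b + k.fst = 0) (c : ℝ) (u : H₁) :
    quadJ M11 M12 (ContinuousLinearMap.adjoint M12) M22 k c (pairL2 u b) =
      quadJ M11 M12 (ContinuousLinearMap.adjoint M12) M22 k c (pairL2 a b)
        + ⟪M11 (u - a), u - a⟫ := by
  have hs : ⟪M11 u, a⟫ = ⟪M11 a, u⟫ := by
    rw [real_inner_comm, ← h11sa.isSymmetric.apply_clm]
  have h0 : ⟪M11 a + M12 b + k.fst, u - a⟫ = 0 := by rw [h, inner_zero_left]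
  simp only [quadJ_pairL2, ContinuousLinearMap.adjoint_inner_left, map_sub, inner_sub_left,
    inner_sub_right, inner_add_left, real_inner_comm _ (M12 b)] at h0 ⊢
  linarith

theorem quadJ_snd_eq_of_stationary (h22sa : IsSelfAdjoint M22)
    (h : ContinuousLinearMap.adjoint M12 a + M22 b + k.snd = 0) (c : ℝ) (u : H₂) :
    quadJ M11 M12 (ContinuousLinearMap.adjoint M12) M22 k c (pairL2 a u) =
      quadJ M11 M12 (ContinuousLinearMap.adjoint M12) M22 k c (pairL2 a b)
        + ⟪M22 (u - b), u - b⟫ := by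
  have hs : ⟪M22 u, b⟫ = ⟪M22 b, u⟫ := by
    rw [real_inner_comm, ← h22sa.isSymmetric.apply_clm]
  have h0 : ⟪ContinuousLinearMap.adjoint M12 a + M22 b + k.snd, u - b⟫ = 0 := by
    rw [h, inner_zero_left]
  simp only [quadJ_pairL2, ContinuousLinearMap.adjoint_inner_left, map_sub, inner_sub_left,
    inner_sub_right, inner_add_left, real_inner_comm a (M12 _)] at h0 ⊢
  linarith

end SaddlePoint

/-- Under the uniform convexity-concavity condition, for every `k` and `c` the quadratic
functional `J(u) = ⟨Mu,u⟩ + 2⟨k,u⟩ + c` admits a unique saddle point, given by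
`u* = −M⁻¹k` (equivalently, `Mu* + k = 0`). -/
theorem exists_unique_saddlePoint_of_uniform_convex_concave {H₁ H₂ : Type*}
    [NormedAddCommGroup H₁] [InnerProductSpace ℝ H₁] [CompleteSpace H₁]
    [NormedAddCommGroup H₂] [InnerProductSpace ℝ H₂] [CompleteSpace H₂]
    (M11 : H₁ →L[ℝ] H₁) (M12 : H₂ →L[ℝ] H₁)
    (M21 : H₁ →L[ℝ] H₂) (M22 : H₂ →L[ℝ] H₂)
    (h21 : M21 = ContinuousLinearMap.adjoint M12)
    (h11sa : IsSelfAdjoint M11) (h22sa : IsSelfAdjoint M22)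
    (α : ℝ) (hα : 0 < α)
    (h11 : ∀ u₁ : H₁, α * ‖u₁‖ ^ 2 ≤ ⟪M11 u₁, u₁⟫)
    (h22 : ∀ u₂ : H₂, ⟪M22 u₂, u₂⟫ ≤ -(α * ‖u₂‖ ^ 2))
    (k : WithLp 2 (H₁ × H₂)) (c : ℝ) :
    ∃ (u₁s : H₁) (u₂s : H₂),
      blockOp M11 M12 M21 M22 (pairL2 u₁s u₂s) + k = 0 ∧
      IsSaddlePoint (quadJ M11 M12 M21 M22 k c) u₁s u₂s ∧
      ∀ (v₁ : H₁) (v₂ : H₂), IsSaddlePoint (quadJ M11 M12 M21 M22 k c) v₁ v₂ →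
        v₁ = u₁s ∧ v₂ = u₂s := by
  subst h21
  obtain ⟨u, hu⟩ := blockOp_surjective (M12 := M12) hα h11 h22 (-k)
  have hu0 : blockOp M11 M12 (ContinuousLinearMap.adjoint M12) M22 u + k = 0 := by
    rw [hu, neg_add_cancel]
  have h1 := quadJ_fst_eq_of_stationary (M22 := M22) (k := k)
    (a := u.fst) (b := u.snd) h11sa (congrArg WithLp.fst hu0) c
  have h2 := quadJ_snd_eq_of_stationary (M11 := M11) (k := k)
    (a := u.fst) (b := u.snd) h22sa (congrArg WithLp.snd hu0) c
  refine ⟨u.fst, u.snd, hu0, ⟨fun u₂ => ?_, fun u₁ => ?_⟩, fun v₁ v₂ hv => ?_⟩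
  · have := mul_nonneg hα.le (sq_nonneg ‖u₂ - u.snd‖)
    linarith [h2 u₂, h22 (u₂ - u.snd)]
  · have := mul_nonneg hα.le (sq_nonneg ‖u₁ - u.fst‖)
    linarith [h1 u₁, h11 (u₁ - u.fst)]
  · have p1 := mul_nonneg hα.le (sq_nonneg ‖v₁ - u.fst‖)
    have p2 := mul_nonneg hα.le (sq_nonneg ‖v₂ - u.snd‖)
    have e1 : α * ‖v₁ - u.fst‖ ^ 2 = 0 := by
      linarith [h1 v₁, h2 v₂, h11 (v₁ - u.fst), h22 (v₂ - u.snd), hv.1 u.snd, hv.2 u.fst]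
    have e2 : α * ‖v₂ - u.snd‖ ^ 2 = 0 := by
      linarith [h1 v₁, h2 v₂, h11 (v₁ - u.fst), h22 (v₂ - u.snd), hv.1 u.snd, hv.2 u.fst]
    simpa [hα.ne', sub_eq_zero] using And.intro e1 e2
end

section
/- Suppose M₁₁ ≥ 0 and −M₂₂ ≥ 0, let k ∈ H, and suppose there exists v ∈ H with Mv + k = 0. Let u* ∈ H be the strong limit of u_ε := −M_ε⁻¹k as ε → 0⁺ (which exists). Then ‖u*‖ ≤ ‖v‖ for every v ∈ H satisfying Mv + k = 0; that is, u* is the minimum-norm solution of the equation Mu + k = 0. -/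
open scoped RealInnerProductSpace

section BlockOp

variable {H₁ H₂ : Type*}
  [NormedAddCommGroup H₁] [InnerProductSpace ℝ H₁]
  [NormedAddCommGroup H₂] [InnerProductSpace ℝ H₂]
  (M11 : H₁ →L[ℝ] H₁) (M12 : H₂ →L[ℝ] H₁) (M21 : H₁ →L[ℝ] H₂) (M22 : H₂ →L[ℝ] H₂)

theorem blockOp_apply_fst (x : WithLp 2 (H₁ × H₂)) :
    (blockOp M11 M12 M21 M22 x).fst = M11 x.fst + M12 x.snd := rfl

theorem blockOp_apply_snd (x : WithLp 2 (H₁ × H₂)) :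
    (blockOp M11 M12 M21 M22 x).snd = M21 x.fst + M22 x.snd := rfl

/-- The signature operator `(u₁, u₂) ↦ (u₁, -u₂)`. -/
noncomputable def signatureOp (H₁ H₂ : Type*)
    [NormedAddCommGroup H₁] [InnerProductSpace ℝ H₁]
    [NormedAddCommGroup H₂] [InnerProductSpace ℝ H₂] :
    WithLp 2 (H₁ × H₂) →L[ℝ] WithLp 2 (H₁ × H₂) :=
  blockOp (ContinuousLinearMap.id ℝ H₁) 0 0 (-ContinuousLinearMap.id ℝ H₂)

theorem signatureOp_apply_fst (x : WithLp 2 (H₁ × H₂)) :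
    (signatureOp H₁ H₂ x).fst = x.fst := by
  simp [signatureOp, blockOp_apply_fst]

theorem signatureOp_apply_snd (x : WithLp 2 (H₁ × H₂)) :
    (signatureOp H₁ H₂ x).snd = -x.snd := by
  simp [signatureOp, blockOp_apply_snd]

theorem inner_signatureOp_signatureOp (x y : WithLp 2 (H₁ × H₂)) :
    ⟪signatureOp H₁ H₂ x, signatureOp H₁ H₂ y⟫ = ⟪x, y⟫ := by
  simp [WithLp.prod_inner_apply, signatureOp_apply_fst, signatureOp_apply_snd]

theorem blockOp_add_smul_id (ε : ℝ) (x : WithLp 2 (H₁ × H₂)) :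
    blockOp (M11 + ε • ContinuousLinearMap.id ℝ H₁) M12 M21
      (M22 - ε • ContinuousLinearMap.id ℝ H₂) x =
    blockOp M11 M12 M21 M22 x + ε • signatureOp H₁ H₂ x := by
  apply (WithLp.equiv 2 (H₁ × H₂)).injective
  refine Prod.ext ?_ ?_
  · change (blockOp _ _ _ _ x).fst = (blockOp _ _ _ _ x).fst + ε • (signatureOp H₁ H₂ x).fst
    simp only [blockOp_apply_fst, signatureOp_apply_fst, add_apply, smul_apply,
      ContinuousLinearMap.id_apply]
    abel
  · change (blockOp _ _ _ _ x).snd = (blockOp _ _ _ _ x).snd + ε • (signatureOp H₁ H₂ x).snd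
    simp only [blockOp_apply_snd, signatureOp_apply_snd, sub_apply, smul_apply,
      ContinuousLinearMap.id_apply, smul_neg]
    abel

theorem inner_blockOp_signatureOp_nonneg [CompleteSpace H₁] [CompleteSpace H₂]
    (h21 : M21 = ContinuousLinearMap.adjoint M12)
    (h11pos : ∀ u₁ : H₁, 0 ≤ ⟪M11 u₁, u₁⟫) (h22neg : ∀ u₂ : H₂, 0 ≤ ⟪(-M22) u₂, u₂⟫)
    (x : WithLp 2 (H₁ × H₂)) :
    0 ≤ ⟪blockOp M11 M12 M21 M22 x, signatureOp H₁ H₂ x⟫ := by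
  have h1 := h11pos x.fst
  have h2 := h22neg x.snd
  have h3 : ⟪M21 x.fst, x.snd⟫ = ⟪M12 x.snd, x.fst⟫ := by
    rw [h21, ContinuousLinearMap.adjoint_inner_left, real_inner_comm]
  rw [neg_apply, inner_neg_left] at h2
  rw [WithLp.prod_inner_apply]
  change 0 ≤ ⟪(blockOp M11 M12 M21 M22 x).fst, (signatureOp H₁ H₂ x).fst⟫ +
    ⟪(blockOp M11 M12 M21 M22 x).snd, (signatureOp H₁ H₂ x).snd⟫
  rw [blockOp_apply_fst, blockOp_apply_snd, signatureOp_apply_fst, signatureOp_apply_snd,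
    inner_add_left, inner_neg_right, inner_add_left]
  linarith

/-- Solutions of the regularized equation are bounded by any solution of the original one. -/
theorem norm_le_of_blockOp_add_smul_signatureOp_eq [CompleteSpace H₁] [CompleteSpace H₂]
    (h21 : M21 = ContinuousLinearMap.adjoint M12)
    (h11pos : ∀ u₁ : H₁, 0 ≤ ⟪M11 u₁, u₁⟫) (h22neg : ∀ u₂ : H₂, 0 ≤ ⟪(-M22) u₂, u₂⟫)
    {ε : ℝ} (hε : 0 < ε) {x v : WithLp 2 (H₁ × H₂)}
    (h : blockOp M11 M12 M21 M22 x + ε • signatureOp H₁ H₂ x = blockOp M11 M12 M21 M22 v) :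
    ‖x‖ ≤ ‖v‖ := by
  have hpos := inner_blockOp_signatureOp_nonneg M11 M12 M21 M22 h21 h11pos h22neg (x - v)
  have hdiff : blockOp M11 M12 M21 M22 (x - v) = -(ε • signatureOp H₁ H₂ x) := by
    rw [map_sub, ← h]
    abel
  rw [hdiff, inner_neg_left, real_inner_smul_left, inner_signatureOp_signatureOp,
    inner_sub_right, real_inner_self_eq_norm_sq] at hpos
  have hcs := real_inner_le_norm x v
  have hle : ‖x‖ ^ 2 ≤ ⟪x, v⟫ := by
    by_contra! hlt
    linarith [mul_pos hε (sub_pos.mpr hlt)]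
  by_contra! hlt
  nlinarith [norm_nonneg v]

end BlockOp

/-- If `M₁₁ ≥ 0`, `−M₂₂ ≥ 0`, `Mv + k = 0` has a solution, and `u*` is the strong limit
as `ε → 0⁺` of the family `u_ε = −M_ε⁻¹k`, then `u*` is the minimum-norm solution of
`Mu + k = 0`: it solves the equation and `‖u*‖ ≤ ‖v‖` for every solution `v`. -/
theorem perturbed_family_limit_is_minimum_norm_solution {H₁ H₂ : Type*}
    [NormedAddCommGroup H₁] [InnerProductSpace ℝ H₁] [CompleteSpace H₁]
    [NormedAddCommGroup H₂] [InnerProductSpace ℝ H₂] [CompleteSpace H₂]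
    (M11 : H₁ →L[ℝ] H₁) (M12 : H₂ →L[ℝ] H₁)
    (M21 : H₁ →L[ℝ] H₂) (M22 : H₂ →L[ℝ] H₂)
    (h21 : M21 = ContinuousLinearMap.adjoint M12)
    (h11sa : IsSelfAdjoint M11) (h22sa : IsSelfAdjoint M22)
    (h11pos : ∀ u₁ : H₁, 0 ≤ ⟪M11 u₁, u₁⟫)
    (h22neg : ∀ u₂ : H₂, 0 ≤ ⟪(-M22) u₂, u₂⟫)
    (k : WithLp 2 (H₁ × H₂))
    (hsol : ∃ v : WithLp 2 (H₁ × H₂), blockOp M11 M12 M21 M22 v + k = 0)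
    (u : ℝ → WithLp 2 (H₁ × H₂))
    (hu : ∀ ε : ℝ, 0 < ε →
      blockOp (M11 + ε • ContinuousLinearMap.id ℝ H₁) M12 M21
        (M22 - ε • ContinuousLinearMap.id ℝ H₂) (u ε) = -k)
    (us : WithLp 2 (H₁ × H₂))
    (hlim : Filter.Tendsto u (nhdsWithin 0 (Set.Ioi 0)) (nhds us)) :
    blockOp M11 M12 M21 M22 us + k = 0 ∧
      ∀ v : WithLp 2 (H₁ × H₂), blockOp M11 M12 M21 M22 v + k = 0 → ‖us‖ ≤ ‖v‖ := by
  simp only [blockOp_add_smul_id] at hu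
  constructor
  · have hε : Filter.Tendsto (fun ε : ℝ => ε) (nhdsWithin 0 (Set.Ioi 0)) (nhds 0) :=
      tendsto_nhdsWithin_of_tendsto_nhds Filter.tendsto_id
    have hM := (((blockOp M11 M12 M21 M22).continuous.tendsto us).comp hlim).add
      (hε.smul (((signatureOp H₁ H₂).continuous.tendsto us).comp hlim))
    rw [zero_smul, add_zero] at hM
    have hk : Filter.Tendsto (fun _ : ℝ => -k) (nhdsWithin 0 (Set.Ioi 0))
        (nhds (blockOp M11 M12 M21 M22 us)) :=
      hM.congr' (by filter_upwards [self_mem_nhdsWithin] with ε hpos using hu ε hpos)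
    rw [tendsto_nhds_unique hk tendsto_const_nhds, neg_add_cancel]
  · intro v hv
    refine le_of_tendsto hlim.norm ?_
    filter_upwards [self_mem_nhdsWithin] with ε hpos
    exact norm_le_of_blockOp_add_smul_signatureOp_eq M11 M12 M21 M22 h21 h11pos h22neg hpos
      ((hu ε hpos).trans (eq_neg_of_add_eq_zero_left hv).symm)
end
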